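/- Let C be a nonempty compact convex subset of a Banach space E and T, U commuting nonexpansive mappings on C. Let x_1 ∈ C and define x_{n+1} = (α_n/n²) Σ_{i=1}^n Σ_{j=1}^n T^i U^j x_n + (1 − α_n) x_n, where {α_n} ⊆ [0,1] with 0 < liminf α_n ≤ limsup α_n < 1. Then {x_n} converges strongly to a common fixed point of T and U. -/

import Mathlib

open Filter

/-- The average of `f` over the square `{1, …, n} × {1, …, n}`. -/
noncomputable def squareAvg {V : Type*} [AddCommGroup V] [Module ℝ V] (f : ℕ × ℕ → V) (n : ℕ) : V :=
  ((n : ℝ) ^ 2)⁻¹ • ∑ g ∈ Finset.Icc 1 n ×ˢ Finset.Icc 1 n, f g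

section SquareAvg

variable {V : Type*} [NormedAddCommGroup V] [NormedSpace ℝ V]

theorem norm_squareAvg_le_squareAvg_norm (f : ℕ × ℕ → V) (n : ℕ) :
    ‖squareAvg f n‖ ≤ squareAvg (fun g => ‖f g‖) n := by
  unfold squareAvg
  rw [norm_smul, smul_eq_mul, Real.norm_of_nonneg (by positivity)]
  gcongr
  exact norm_sum_le _ _

theorem squareAvg_mono {f g : ℕ × ℕ → ℝ} (h : ∀ p, f p ≤ g p) (n : ℕ) :
    squareAvg f n ≤ squareAvg g n := by
  unfold squareAvg
  rw [smul_eq_mul, smul_eq_mul]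
  gcongr with p
  exact h p

theorem squareAvg_const (v : V) {n : ℕ} (hn : 1 ≤ n) : squareAvg (fun _ => v) n = v := by
  have : (n : ℝ) ≠ 0 := by positivity
  unfold squareAvg
  rw [Finset.sum_const, Finset.card_product, Nat.card_Icc, ← Nat.cast_smul_eq_nsmul ℝ, smul_smul]
  simp only [add_tsub_cancel_right, Nat.cast_mul]
  rw [← sq, inv_mul_cancel₀ (by positivity), one_smul]

theorem squareAvg_sub (f g : ℕ × ℕ → V) (n : ℕ) :
    squareAvg (fun p => f p - g p) n = squareAvg f n - squareAvg g n := by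
  simp [squareAvg, Finset.sum_sub_distrib, smul_sub]

theorem squareAvg_sum {ι : Type*} (s : Finset ι) (f : ι → ℕ × ℕ → V) (n : ℕ) :
    squareAvg (fun p => ∑ i ∈ s, f i p) n = ∑ i ∈ s, squareAvg (f i) n := by
  simp only [squareAvg]
  rw [Finset.sum_comm, Finset.smul_sum]

theorem norm_squareAvg_le {f : ℕ × ℕ → V} {B : ℝ} (hf : ∀ p, ‖f p‖ ≤ B) {n : ℕ} (hn : 1 ≤ n) :
    ‖squareAvg f n‖ ≤ B :=
  (norm_squareAvg_le_squareAvg_norm f n).trans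
    ((squareAvg_mono hf n).trans_eq (squareAvg_const B hn))

theorem Convex.squareAvg_mem {C : Set V} (hC : Convex ℝ C) {f : ℕ × ℕ → V} (hf : ∀ p, f p ∈ C)
    {n : ℕ} (hn : 1 ≤ n) : squareAvg f n ∈ C := by
  have : (n : ℝ) ≠ 0 := by positivity
  unfold squareAvg
  rw [Finset.smul_sum]
  refine hC.sum_mem (fun _ _ => by positivity) ?_ fun p _ => hf p
  simp only [Finset.sum_const, Finset.card_product, Nat.card_Icc, nsmul_eq_mul,
    add_tsub_cancel_right, Nat.cast_mul]
  field_simp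

theorem norm_squareAvg_succ_sub_le {f : ℕ × ℕ → V} {B : ℝ} (hf : ∀ p, ‖f p‖ ≤ B) {n : ℕ}
    (hn : 1 ≤ n) : ‖squareAvg f (n + 1) - squareAvg f n‖ ≤ 4 * B / (n + 1) := by
  have hn0 : (0 : ℝ) < n := by positivity
  have hB : 0 ≤ B := (norm_nonneg _).trans (hf 0)
  set Q : ℕ → Finset (ℕ × ℕ) := fun m => Finset.Icc 1 m ×ˢ Finset.Icc 1 m with hQ
  have hsub : Q n ⊆ Q (n + 1) := by
    apply Finset.product_subset_product <;> exact Finset.Icc_subset_Icc_right (by omega)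
  have hcard (m : ℕ) : (Q m).card = m * m := by simp [hQ]
  have hrest : ‖∑ p ∈ Q (n + 1) \ Q n, f p‖ ≤ (2 * n + 1) * B := by
    refine (norm_sum_le_of_le _ fun p _ => hf p).trans_eq ?_
    rw [Finset.sum_const, Finset.card_sdiff_of_subset hsub, hcard, hcard, nsmul_eq_mul]
    congr 1
    rw [Nat.cast_sub (by nlinarith)]
    push_cast
    ring
  have heq : squareAvg f (n + 1) - squareAvg f n =
      (((n : ℝ) + 1) ^ 2)⁻¹ • ∑ p ∈ Q (n + 1) \ Q n, f p
        - ((2 * n + 1) / ((n : ℝ) + 1) ^ 2) • squareAvg f n := by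
    have h1 : squareAvg f (n + 1) =
        (((n : ℝ) + 1) ^ 2)⁻¹ • (∑ p ∈ Q (n + 1) \ Q n, f p + ∑ p ∈ Q n, f p) := by
      rw [Finset.sum_sdiff hsub]; simp [squareAvg, hQ]
    have h2 : ∑ p ∈ Q n, f p = ((n : ℝ) ^ 2) • squareAvg f n := by
      rw [squareAvg, smul_smul, mul_inv_cancel₀ (by positivity), one_smul]
    rw [h1, h2]
    match_scalars <;> field_simp
    ring
  rw [heq]
  refine (norm_sub_le _ _).trans ?_
  rw [norm_smul, norm_smul, Real.norm_of_nonneg (by positivity), Real.norm_of_nonneg (by positivity)]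
  calc _ ≤ (((n : ℝ) + 1) ^ 2)⁻¹ * ((2 * n + 1) * B) + ((2 * n + 1) / ((n : ℝ) + 1) ^ 2) * B := by
        gcongr
        exact norm_squareAvg_le hf hn
    _ ≤ _ := by
        rw [le_div_iff₀ (by positivity)]
        field_simp
        nlinarith

theorem tendsto_squareAvg_shift_fst_sub {f : ℕ × ℕ → V} {B : ℝ} (hf : ∀ p, ‖f p‖ ≤ B) :
    Tendsto (fun n => squareAvg (fun p => f (p + (1, 0))) n - squareAvg f n) atTop (nhds 0) := by
  have htel (n j : ℕ) : ∑ i ∈ Finset.Icc 1 n, (f ((i, j) + (1, 0)) - f (i, j)) =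
      f (n + 1, j) - f (1, j) := by
    induction n with
    | zero => simp
    | succ n ih => rw [Finset.sum_Icc_succ_top (by omega), ih]; simp
  refine squeeze_zero_norm' (a := fun n : ℕ => 2 * B * (n : ℝ)⁻¹) ?_ ?_
  · filter_upwards [eventually_ge_atTop 1] with n hn
    have hn0 : (0 : ℝ) < n := by positivity
    rw [← squareAvg_sub, squareAvg, Finset.sum_product_right, norm_smul,
      Real.norm_of_nonneg (by positivity), Finset.sum_congr rfl fun j _ => htel n j]
    have : ‖∑ j ∈ Finset.Icc 1 n, (f (n + 1, j) - f (1, j))‖ ≤ n * (2 * B) := by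
      refine (norm_sum_le_of_le _ fun j _ => (norm_sub_le _ _).trans
        (add_le_add (hf _) (hf _))).trans_eq ?_
      simp
      ring
    calc _ ≤ ((n : ℝ) ^ 2)⁻¹ * (n * (2 * B)) := by gcongr
      _ = _ := by field_simp
  · simpa using (tendsto_inv_atTop_nhds_zero_nat (𝕜 := ℝ)).const_mul (2 * B)

theorem squareAvg_comp_swap (f : ℕ × ℕ → V) (n : ℕ) :
    squareAvg (fun p => f p.swap) n = squareAvg f n := by
  unfold squareAvg
  rw [Finset.sum_product_right, Finset.sum_product]
  rfl

theorem tendsto_squareAvg_shift_snd_sub {f : ℕ × ℕ → V} {B : ℝ} (hf : ∀ p, ‖f p‖ ≤ B) :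
    Tendsto (fun n => squareAvg (fun p => f (p + (0, 1))) n - squareAvg f n) atTop (nhds 0) := by
  refine (tendsto_squareAvg_shift_fst_sub (f := fun p => f p.swap) fun p => hf _).congr fun n => ?_
  rw [squareAvg_comp_swap, ← squareAvg_comp_swap fun p => f (p + (0, 1))]
  rfl

theorem tendsto_squareAvg_shift_sub {f : ℕ × ℕ → V} {B : ℝ} (hf : ∀ p, ‖f p‖ ≤ B) (k : ℕ × ℕ) :
    Tendsto (fun n => squareAvg (fun p => f (p + k)) n - squareAvg f n) atTop (nhds 0) := by
  obtain ⟨a, b⟩ := k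
  induction a with
  | zero =>
    induction b with
    | zero => simp [← Prod.zero_eq_mk]
    | succ b ih =>
      have h := tendsto_squareAvg_shift_snd_sub (f := fun p => f (p + (0, b))) fun p => hf _
      simpa [add_assoc, add_comm 1] using h.add ih
  | succ a ih =>
    have h := tendsto_squareAvg_shift_fst_sub (f := fun p => f (p + (a, b))) fun p => hf _
    simpa [add_assoc, add_comm 1] using h.add ih

theorem exists_tendsto_squareAvg (F : Ultrafilter ℕ) (hF : (F : Filter ℕ) ≤ atTop)
    {f : ℕ × ℕ → ℝ} {B : ℝ} (hf : ∀ p, ‖f p‖ ≤ B) :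
    ∃ l, Tendsto (squareAvg f) F (nhds l) := by
  have hmem : ∀ᶠ n in (F : Filter ℕ), squareAvg f n ∈ Metric.closedBall (0 : ℝ) B :=
    hF ((eventually_ge_atTop 1).mono fun n hn => by
      simpa using norm_squareAvg_le hf hn)
  obtain ⟨l, -, hl⟩ := (isCompact_closedBall (0 : ℝ) B).ultrafilter_le_nhds
    (F.map (squareAvg f)) (le_principal_iff.2 hmem)
  exact ⟨l, hl⟩

/-- A sequence indexed by `ℕ × ℕ` with totally bounded range, along which translations are
nonexpansive, is constant as soon as its averages accumulate at its initial term. -/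
theorem eq_initial_of_tendsto_squareAvg (F : Ultrafilter ℕ) (hF : (F : Filter ℕ) ≤ atTop)
    {a : ℕ × ℕ → V} (hnonexp : ∀ g h k, ‖a (g + k) - a (h + k)‖ ≤ ‖a g - a h‖)
    (hbdd : TotallyBounded (Set.range a)) (hlim : Tendsto (squareAvg a) F (nhds (a 0)))
    (g : ℕ × ℕ) : a g = a 0 := by
  obtain ⟨B, hB⟩ : ∃ B, ∀ g h, ‖a g - a h‖ ≤ B := by
    obtain ⟨B, hB⟩ := Metric.isBounded_iff.1 hbdd.isBounded
    exact ⟨B, fun g h => by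
      simpa [dist_eq_norm] using hB (Set.mem_range_self g) (Set.mem_range_self h)⟩
  have hge1 : ∀ᶠ n in (F : Filter ℕ), 1 ≤ n := hF (eventually_ge_atTop 1)
  have hB' (h g : ℕ × ℕ) : ‖(fun g => ‖a g - a h‖) g‖ ≤ B := by simpa using hB g h
  choose φ hφ using fun h => exists_tendsto_squareAvg F hF (hB' h)
  have hshift (h k : ℕ × ℕ) :
      Tendsto (squareAvg fun g => ‖a (g + k) - a h‖) F (nhds (φ h)) := by
    simpa using ((tendsto_squareAvg_shift_sub (hB' h) k).mono_left hF).add (hφ h)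
  have hz (h : ℕ × ℕ) : ‖a 0 - a h‖ ≤ φ h := by
    refine le_of_tendsto_of_tendsto (hlim.sub_const (a h)).norm (hφ h) ?_
    filter_upwards [hge1] with n hn
    conv_lhs => rw [← squareAvg_const (a h) hn, ← squareAvg_sub]
    exact norm_squareAvg_le_squareAvg_norm _ _
  have hanti (h k : ℕ × ℕ) : φ (h + k) ≤ φ h :=
    le_of_tendsto_of_tendsto' (hshift (h + k) k) (hφ h) fun n =>
      squareAvg_mono (fun g => hnonexp g h k) n
  have hφ0 (h : ℕ × ℕ) : φ h ≤ φ 0 := by simpa using hanti 0 h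
  have hφB (h : ℕ × ℕ) : ‖φ h‖ ≤ φ 0 := by
    rw [Real.norm_of_nonneg ((norm_nonneg _).trans (hz h))]
    exact hφ0 h
  obtain ⟨m, hm⟩ := exists_tendsto_squareAvg F hF hφB
  have hconst (h : ℕ × ℕ) : φ h = φ 0 := by
    refine le_antisymm (hφ0 h) (le_trans (b := m) ?_ ?_)
    · refine le_of_tendsto_of_tendsto' (hφ 0) hm fun n => squareAvg_mono (fun g => ?_) n
      rw [norm_sub_rev]
      exact hz g
    · have h1 : Tendsto (squareAvg fun g => φ (g + h)) F (nhds m) := by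
        simpa using ((tendsto_squareAvg_shift_sub hφB h).mono_left hF).add hm
      refine le_of_tendsto h1 ?_
      filter_upwards [hge1] with n hn
      refine (squareAvg_mono (g := fun _ => φ h) (fun g => ?_) n).trans_eq (squareAvg_const _ hn)
      rw [add_comm]
      exact hanti h g
  have hle (g h : ℕ × ℕ) : ‖a (g + h) - a h‖ ≤ φ 0 := by
    have := hnonexp g 0 h
    rw [zero_add, norm_sub_rev (a g)] at this
    exact this.trans ((hz g).trans (hφ0 g))
  have hφ_nonpos : φ 0 ≤ 0 := by
    by_contra! hpos
    obtain ⟨s, hs⟩ : ∃ s : Finset (ℕ × ℕ), ∀ g, ∃ h ∈ s, ‖a g - a h‖ < φ 0 / 2 := by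
      obtain ⟨t, ht_sub, ht_fin, ht⟩ :=
        Metric.finite_approx_of_totallyBounded hbdd _ (half_pos hpos)
      refine ⟨ht_fin.toFinset.image (Function.invFun a), fun g => ?_⟩
      obtain ⟨y, hy, hgy⟩ := Set.mem_iUnion₂.1 (ht (Set.mem_range_self g))
      refine ⟨_, Finset.mem_image_of_mem _ (ht_fin.mem_toFinset.2 hy), ?_⟩
      rwa [Function.invFun_eq (ht_sub hy), ← dist_eq_norm]
    obtain ⟨k, hk⟩ := s.exists_le
    have hnonneg (g : ℕ × ℕ) : ∀ h ∈ s, 0 ≤ φ 0 - ‖a (g + k) - a h‖ := by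
      intro h hh
      obtain ⟨r, rfl⟩ := exists_add_of_le (hk h hh)
      have := hle (g + r) h
      rw [add_assoc, add_comm r] at this
      linarith
    have hsum (g : ℕ × ℕ) : φ 0 / 2 ≤ ∑ h ∈ s, (φ 0 - ‖a (g + k) - a h‖) := by
      obtain ⟨h, hh, hgh⟩ := hs (g + k)
      exact le_trans (by linarith) (Finset.single_le_sum (hnonneg g) hh)
    have hlim0 : Tendsto (squareAvg fun g => ∑ h ∈ s, (φ 0 - ‖a (g + k) - a h‖)) F (nhds 0) := by
      have : Tendsto (fun n => ∑ h ∈ s, (φ 0 - squareAvg (fun g => ‖a (g + k) - a h‖) n)) F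
          (nhds (∑ h ∈ s, (φ 0 - φ h))) :=
        tendsto_finsetSum _ fun h _ => (hshift h k).const_sub _
      simp only [hconst, sub_self, Finset.sum_const_zero] at this
      refine this.congr' ?_
      filter_upwards [hge1] with n hn
      rw [squareAvg_sum]
      refine Finset.sum_congr rfl fun h _ => ?_
      rw [squareAvg_sub, squareAvg_const _ hn]
    have : φ 0 / 2 ≤ 0 := by
      refine ge_of_tendsto hlim0 ?_
      filter_upwards [hge1] with n hn
      exact (squareAvg_const (φ 0 / 2) hn).symm.trans_le (squareAvg_mono hsum n)
    linarith
  have := (hz g).trans ((hφ0 g).trans hφ_nonpos)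
  exact (sub_eq_zero.1 (norm_le_zero_iff.1 this)).symm

end SquareAvg

section Suzuki

variable {V : Type*} [NormedAddCommGroup V] [NormedSpace ℝ V]

theorem norm_sub_le_sum_of_relaxation {x w : ℕ → V} {α : ℕ → ℝ} {d ε : ℝ} {n k : ℕ} (hε : 0 ≤ ε)
    (hα : ∀ i, n ≤ i → 0 ≤ α i ∧ α i ≤ 1)
    (hx : ∀ i, n ≤ i → x (i + 1) = α i • w i + (1 - α i) • x i)
    (hw : ∀ i, n ≤ i → ‖w (i + 1) - w i‖ ≤ ‖x (i + 1) - x i‖ + ε)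
    (hd : ∀ i, n ≤ i → ‖w i - x i‖ ≤ d + ε) :
    ‖w (n + k) - w n‖ ≤ (∑ i ∈ Finset.range k, α (n + i)) * d + 2 * k * ε := by
  induction k with
  | zero => simp
  | succ k ih =>
    have hle : n ≤ n + k := Nat.le_add_right n k
    have hstep : x (n + k + 1) - x (n + k) = α (n + k) • (w (n + k) - x (n + k)) := by
      rw [hx _ hle]; module
    have h1 := hw _ hle
    rw [hstep, norm_smul, Real.norm_of_nonneg (hα _ hle).1] at h1
    have h2 := mul_le_mul_of_nonneg_left (hd _ hle) (hα _ hle).1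
    have h3 := mul_le_of_le_one_left hε (hα _ hle).2
    have h4 := norm_sub_le_norm_sub_add_norm_sub (w (n + k + 1)) (w (n + k)) (w n)
    rw [Finset.sum_range_succ, ← add_assoc]
    push_cast
    linarith

theorem exists_le_norm_sub_of_relaxation {x w : ℕ → V} {α : ℕ → ℝ} {b d : ℝ} (hb : b < 1) (k : ℕ) :
    ∃ K : ℝ, ∀ ε : ℝ, 0 ≤ ε → ∀ n : ℕ,
      (∀ i, n ≤ i → 0 ≤ α i ∧ α i ≤ b) →
      (∀ i, n ≤ i → x (i + 1) = α i • w i + (1 - α i) • x i) →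
      (∀ i, n ≤ i → ‖w (i + 1) - w i‖ ≤ ‖x (i + 1) - x i‖ + ε) →
      (∀ i, n ≤ i → ‖w i - x i‖ ≤ d + ε) →
      d - ε ≤ ‖w (n + k) - x (n + k)‖ →
      (1 + ∑ i ∈ Finset.range k, α (n + i)) * d - K * ε ≤ ‖w (n + k) - x n‖ := by
  induction k with
  | zero => exact ⟨1, fun ε _ n _ _ _ _ h => by simpa using h⟩
  | succ k ih =>
    obtain ⟨K, hK⟩ := ih
    refine ⟨(|K| + 2 * (k + 1)) / (1 - b), fun ε hε n hα hx hw hd hlow => ?_⟩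
    have hα1 (i : ℕ) (hi : n ≤ i) : 0 ≤ α i ∧ α i ≤ 1 :=
      ⟨(hα i hi).1, (hα i hi).2.trans hb.le⟩
    have hup := norm_sub_le_sum_of_relaxation (k := k + 1) hε hα1 hx hw hd
    have hrec := hK ε hε (n + 1) (fun i hi => hα i (by omega)) (fun i hi => hx i (by omega))
      (fun i hi => hw i (by omega)) (fun i hi => hd i (by omega))
      (by rwa [add_right_comm, add_assoc])
    obtain ⟨h0, hle⟩ := hα n le_rfl
    have htri : ‖w (n + (k + 1)) - x (n + 1)‖ ≤
        α n * ‖w (n + (k + 1)) - w n‖ + (1 - α n) * ‖w (n + (k + 1)) - x n‖ := by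
      have : w (n + (k + 1)) - x (n + 1) =
          α n • (w (n + (k + 1)) - w n) + (1 - α n) • (w (n + (k + 1)) - x n) := by
        rw [hx n le_rfl]; module
      rw [this]
      refine (norm_add_le _ _).trans_eq ?_
      rw [norm_smul, norm_smul, Real.norm_of_nonneg h0, Real.norm_of_nonneg (by linarith)]
    have hidx : n + 1 + k = n + (k + 1) := by omega
    rw [hidx] at hrec
    have hS : ∑ i ∈ Finset.range (k + 1), α (n + i) =
        ∑ i ∈ Finset.range k, α (n + 1 + i) + α n := by
      rw [Finset.sum_range_succ']
      simp [add_assoc, add_comm 1]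
    rw [hS] at hup ⊢
    set S := ∑ i ∈ Finset.range k, α (n + 1 + i)
    set L := ‖w (n + (k + 1)) - x n‖
    have h1 := mul_le_mul_of_nonneg_left hup h0
    have h2 : α n * (2 * (k + 1 : ℕ) * ε) ≤ 2 * (k + 1) * ε := by
      push_cast
      exact mul_le_of_le_one_left (by positivity) (by linarith)
    have h3 : K * ε ≤ |K| * ε := mul_le_mul_of_nonneg_right (le_abs_self K) hε
    have hmain : (1 - α n) * ((1 + (S + α n)) * d) - (|K| + 2 * (k + 1)) * ε ≤ (1 - α n) * L := by
      linarith
    set M := |K| + 2 * ((k : ℝ) + 1)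
    have hM : 0 ≤ M := by positivity
    have h4 : M * ε ≤ (1 - α n) * (M / (1 - b) * ε) := by
      have : M * ε = (1 - b) * (M / (1 - b) * ε) := by
        have : 1 - b ≠ 0 := by linarith
        field_simp
      rw [this]
      have : 0 ≤ 1 - b := by linarith
      gcongr
    refine le_of_mul_le_mul_left (a := 1 - α n) ?_ (by linarith)
    linarith

/-- **Suzuki's lemma**: in a bounded relaxation scheme `x (n + 1) = α n • w n + (1 - α n) • x n`
with `α` bounded away from `0` and `1`, if the increments of `w` asymptotically do not exceed those
of `x`, then `‖w n - x n‖` tends to `0`. -/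
theorem tendsto_norm_sub_of_relaxation {x w : ℕ → V} {α : ℕ → ℝ} {a b B : ℝ} (ha : 0 < a)
    (hb : b < 1) (hα : ∀ᶠ n in atTop, a ≤ α n ∧ α n ≤ b)
    (hx : ∀ᶠ n in atTop, x (n + 1) = α n • w n + (1 - α n) • x n)
    (hw : ∀ ε > 0, ∀ᶠ n in atTop, ‖w (n + 1) - w n‖ ≤ ‖x (n + 1) - x n‖ + ε)
    (hB : ∀ᶠ n in atTop, ∀ m ≥ n, ‖w m - x n‖ ≤ B) :
    Tendsto (fun n => ‖w n - x n‖) atTop (nhds 0) := by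
  have hBd : IsBoundedUnder (· ≤ ·) atTop fun n => ‖w n - x n‖ :=
    ⟨B, eventually_map.2 (hB.mono fun n hn => hn n le_rfl)⟩
  have hBd' : IsBoundedUnder (· ≥ ·) atTop fun n => ‖w n - x n‖ :=
    isBoundedUnder_of ⟨0, fun n => norm_nonneg _⟩
  set d := limsup (fun n => ‖w n - x n‖) atTop with hd
  have hd0 : 0 ≤ d := le_limsup_of_frequently_le (Frequently.of_forall fun n => norm_nonneg _) hBd
  have hkey (k : ℕ) : (1 + k * a) * d ≤ B := by
    obtain ⟨K, hK⟩ := exists_le_norm_sub_of_relaxation (x := x) (w := w) (α := α) (d := d) hb k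
    have hε (ε : ℝ) (hε : 0 < ε) : (1 + k * a) * d - K * ε ≤ B := by
      have hup : ∀ᶠ n in atTop, ‖w n - x n‖ < d + ε :=
        eventually_lt_of_limsup_lt (by linarith) hBd
      have hfreq : ∃ᶠ n in atTop, d - ε < ‖w n - x n‖ :=
        frequently_lt_of_lt_limsup hBd'.isCoboundedUnder_le (by linarith)
      obtain ⟨N, hN⟩ := eventually_atTop.1 (((hα.and hx).and ((hw ε hε).and hup)).and hB)
      obtain ⟨m, hm, hlow⟩ := frequently_atTop.1 hfreq (N + k)
      obtain ⟨n, rfl⟩ := Nat.exists_eq_add_of_le' (show k ≤ m by omega)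
      have hn : N ≤ n := by omega
      have := hK ε hε.le n (fun i hi => ⟨ha.le.trans (hN i (hn.trans hi)).1.1.1.1,
        (hN i (hn.trans hi)).1.1.1.2⟩) (fun i hi => (hN i (hn.trans hi)).1.1.2)
        (fun i hi => (hN i (hn.trans hi)).1.2.1) (fun i hi => (hN i (hn.trans hi)).1.2.2.le) hlow.le
      have hsum : k * a ≤ ∑ i ∈ Finset.range k, α (n + i) := by
        simpa using Finset.card_nsmul_le_sum (Finset.range k) (fun i => α (n + i)) a
          fun i _ => (hN (n + i) (by omega)).1.1.1.1
      have hBn := (hN n hn).2 (n + k) (by omega)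
      have := mul_le_mul_of_nonneg_right hsum hd0
      linarith
    have hcont : Tendsto (fun ε : ℝ => (1 + k * a) * d - K * ε) (nhdsWithin 0 (Set.Ioi 0))
        (nhds ((1 + k * a) * d - K * 0)) :=
      Tendsto.mono_left (Continuous.tendsto (by fun_prop) 0) nhdsWithin_le_nhds
    rw [mul_zero, sub_zero] at hcont
    exact le_of_tendsto hcont (eventually_mem_nhdsWithin.mono fun ε h => hε ε h)
  have hd_nonpos : d ≤ 0 := by
    by_contra! hpos
    obtain ⟨k, hk⟩ := exists_nat_gt (B / (a * d))
    rw [div_lt_iff₀ (by positivity)] at hk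
    linarith [hkey k]
  refine tendsto_of_le_liminf_of_limsup_le ?_ hd_nonpos hBd hBd'
  exact le_liminf_of_le hBd.isCoboundedUnder_ge (Eventually.of_forall fun n => norm_nonneg _)

end Suzuki

theorem comp_iterate_comm_of_mapsTo {X : Type*} {C : Set X} {T U : X → X}
    (hTmaps : Set.MapsTo T C C)
    (hcomm : ∀ x ∈ C, T (U x) = U (T x)) (i : ℕ) {y : X} (hy : y ∈ C) :
    U (T^[i] y) = T^[i] (U y) := by
  induction i with
  | zero => rfl
  | succ i ih => rw [Function.iterate_succ_apply', Function.iterate_succ_apply', ← ih,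
      hcomm _ (hTmaps.iterate i hy)]

section Orbit

variable {E : Type*} [NormedAddCommGroup E] {C : Set E} {T U : E → E}

theorem norm_iterate_iterate_add_sub_le (hTmaps : Set.MapsTo T C C) (hUmaps : Set.MapsTo U C C)
    (hTne : ∀ x ∈ C, ∀ y ∈ C, ‖T x - T y‖ ≤ ‖x - y‖)
    (hUne : ∀ x ∈ C, ∀ y ∈ C, ‖U x - U y‖ ≤ ‖x - y‖)
    (hcomm : ∀ x ∈ C, T (U x) = U (T x)) {y z : E} (hy : y ∈ C) (hz : z ∈ C) (g h k : ℕ × ℕ) :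
    ‖T^[(g + k).1] (U^[(g + k).2] y) - T^[(h + k).1] (U^[(h + k).2] z)‖ ≤
      ‖T^[g.1] (U^[g.2] y) - T^[h.1] (U^[h.2] z)‖ := by
  have hmem (i j : ℕ) {v : E} (hv : v ∈ C) : T^[i] (U^[j] v) ∈ C :=
    hTmaps.iterate i (hUmaps.iterate j hv)
  obtain ⟨a, b⟩ := k
  simp only [Prod.fst_add, Prod.snd_add]
  induction a with
  | zero =>
    induction b with
    | zero => rfl
    | succ b ih =>
      refine le_trans ?_ ih
      have hU (i j : ℕ) {v : E} (hv : v ∈ C) :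
          T^[i + 0] (U^[j + (b + 1)] v) = U (T^[i + 0] (U^[j + b] v)) := by
        rw [comp_iterate_comm_of_mapsTo hTmaps hcomm _ (hUmaps.iterate _ hv), ← add_assoc,
          Function.iterate_succ_apply']
      rw [hU _ _ hy, hU _ _ hz]
      exact hUne _ (hmem _ _ hy) _ (hmem _ _ hz)
  | succ a ih =>
    refine le_trans ?_ ih
    rw [← add_assoc, ← add_assoc, Function.iterate_succ_apply', Function.iterate_succ_apply']
    exact hTne _ (hmem _ _ hy) _ (hmem _ _ hz)

theorem norm_iterate_iterate_sub_le (hTmaps : Set.MapsTo T C C) (hUmaps : Set.MapsTo U C C)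
    (hTne : ∀ x ∈ C, ∀ y ∈ C, ‖T x - T y‖ ≤ ‖x - y‖)
    (hUne : ∀ x ∈ C, ∀ y ∈ C, ‖U x - U y‖ ≤ ‖x - y‖)
    (hcomm : ∀ x ∈ C, T (U x) = U (T x)) {y z : E} (hy : y ∈ C) (hz : z ∈ C) (g : ℕ × ℕ) :
    ‖T^[g.1] (U^[g.2] y) - T^[g.1] (U^[g.2] z)‖ ≤ ‖y - z‖ := by
  simpa using norm_iterate_iterate_add_sub_le hTmaps hUmaps hTne hUne hcomm hy hz 0 0 g

end Orbit

/-- Let `C` be a nonempty compact convex subset of a Banach space and `T, U`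
commuting nonexpansive self-mappings of `C`.  The Krasnoselskii–Mann iteration
`x_{n+1} = (α_n/n²) Σ_{i=1}^n Σ_{j=1}^n T^i U^j x_n + (1 - α_n) x_n` with
`x_1 ∈ C` and `0 < liminf α_n ≤ limsup α_n < 1` converges strongly to a common
fixed point of `T` and `U`. -/
theorem stmt11 {E : Type*} [NormedAddCommGroup E] [NormedSpace ℝ E] [CompleteSpace E]
    (C : Set E) (hCne : C.Nonempty) (hCcpt : IsCompact C) (hCconv : Convex ℝ C)
    (T U : E → E)
    (hTmaps : Set.MapsTo T C C) (hUmaps : Set.MapsTo U C C)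
    (hTne : ∀ x ∈ C, ∀ y ∈ C, ‖T x - T y‖ ≤ ‖x - y‖)
    (hUne : ∀ x ∈ C, ∀ y ∈ C, ‖U x - U y‖ ≤ ‖x - y‖)
    (hcomm : ∀ x ∈ C, T (U x) = U (T x))
    (α : ℕ → ℝ) (hα : ∀ n, α n ∈ Set.Icc (0 : ℝ) 1)
    (h₁ : 0 < liminf α atTop) (h₂ : limsup α atTop < 1)
    (x : ℕ → E) (hx1 : x 1 ∈ C)
    (hrec : ∀ n ≥ 1, x (n + 1) =
      (α n / (n : ℝ) ^ 2) •
          (∑ i ∈ Finset.Icc 1 n, ∑ j ∈ Finset.Icc 1 n, T^[i] (U^[j] (x n)))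
        + (1 - α n) • x n) :
    ∃ z ∈ C, T z = z ∧ U z = z ∧ Tendsto x atTop (nhds z) := by
  set S : E → ℕ × ℕ → E := fun y g => T^[g.1] (U^[g.2] y) with hS
  have hSmem {y : E} (hy : y ∈ C) (g : ℕ × ℕ) : S y g ∈ C :=
    hTmaps.iterate _ (hUmaps.iterate _ hy)
  have hA {y z : E} (hy : y ∈ C) (hz : z ∈ C) {n : ℕ} (hn : 1 ≤ n) :
      ‖squareAvg (S y) n - squareAvg (S z) n‖ ≤ ‖y - z‖ := by
    rw [← squareAvg_sub]
    exact norm_squareAvg_le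
      (norm_iterate_iterate_sub_le hTmaps hUmaps hTne hUne hcomm hy hz) hn
  have hrec' (n : ℕ) (hn : 1 ≤ n) :
      x (n + 1) = α n • squareAvg (S (x n)) n + (1 - α n) • x n := by
    rw [hrec n hn, squareAvg, Finset.sum_product, smul_smul, div_eq_mul_inv]
  have hxC (n : ℕ) (hn : 1 ≤ n) : x n ∈ C := by
    induction n, hn using Nat.le_induction with
    | base => exact hx1
    | succ n hn ih =>
      rw [hrec' n hn]
      exact hCconv (hCconv.squareAvg_mem (hSmem ih) hn) ih (hα n).1 (by linarith [(hα n).2])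
        (by ring)
  obtain ⟨B, hB⟩ := hCcpt.isBounded.exists_norm_le
  have hAx : Tendsto (fun n => ‖squareAvg (S (x n)) n - x n‖) atTop (nhds 0) := by
    obtain ⟨a, ha, haα⟩ := exists_between h₁
    obtain ⟨b, hbα, hb⟩ := exists_between h₂
    have hlow : IsBoundedUnder (· ≥ ·) atTop α := isBoundedUnder_of ⟨0, fun n => (hα n).1⟩
    have hup : IsBoundedUnder (· ≤ ·) atTop α := isBoundedUnder_of ⟨1, fun n => (hα n).2⟩
    refine tendsto_norm_sub_of_relaxation (B := B + B) ha hb ?_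
      ((eventually_ge_atTop 1).mono hrec') (fun ε hε => ?_) ?_
    · filter_upwards [eventually_lt_of_lt_liminf haα hlow, eventually_lt_of_limsup_lt hbα hup]
        with n h h' using ⟨h.le, h'.le⟩
    · have hlim : Tendsto (fun n : ℕ => 4 * B / ((n : ℝ) + 1)) atTop (nhds 0) := by
        simpa [div_eq_mul_inv] using
          (tendsto_one_div_add_atTop_nhds_zero_nat (𝕜 := ℝ)).const_mul (4 * B)
      filter_upwards [eventually_ge_atTop 1, hlim.eventually_lt_const hε] with n hn hnε
      have h1 := hA (hxC (n + 1) (by omega)) (hxC n hn) (Nat.le_add_left 1 n)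
      have h2 := norm_squareAvg_succ_sub_le (fun g => hB _ (hSmem (hxC n hn) g)) hn
      have h3 := norm_sub_le_norm_sub_add_norm_sub (squareAvg (S (x (n + 1))) (n + 1))
        (squareAvg (S (x n)) (n + 1)) (squareAvg (S (x n)) n)
      linarith
    · filter_upwards [eventually_ge_atTop 1] with n hn m hm
      exact (norm_sub_le _ _).trans (add_le_add
        (hB _ (hCconv.squareAvg_mem (hSmem (hxC m (hn.trans hm))) (hn.trans hm)))
        (hB _ (hxC n hn)))
  obtain ⟨F, hF⟩ : ∃ F : Ultrafilter ℕ, (F : Filter ℕ) ≤ atTop := Ultrafilter.exists_le atTop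
  have hge1 : ∀ᶠ n in (F : Filter ℕ), 1 ≤ n := hF (eventually_ge_atTop 1)
  obtain ⟨z, hz, hxz⟩ := hCcpt.ultrafilter_le_nhds (F.map x)
    (le_principal_iff.2 (hge1.mono hxC))
  replace hxz : Tendsto x F (nhds z) := hxz
  have hAz : Tendsto (squareAvg (S z)) F (nhds (S z 0)) := by
    have h1 : Tendsto (fun n => squareAvg (S (x n)) n) F (nhds z) := by
      simpa using (tendsto_zero_iff_norm_tendsto_zero.2 (hAx.mono_left hF)).add hxz
    have h2 : Tendsto (fun n => squareAvg (S z) n - squareAvg (S (x n)) n) F (nhds 0) := by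
      refine squeeze_zero_norm' (a := fun n => ‖z - x n‖) ?_ ?_
      · filter_upwards [hge1] with n hn using hA hz (hxC n hn) hn
      · simpa using (hxz.const_sub z).norm
    simpa [hS] using h2.add h1
  have hfix (g : ℕ × ℕ) : S z g = z :=
    eq_initial_of_tendsto_squareAvg F hF
      (norm_iterate_iterate_add_sub_le hTmaps hUmaps hTne hUne hcomm hz hz)
      (hCcpt.totallyBounded.subset (Set.range_subset_iff.2 (hSmem hz))) hAz g
  refine ⟨z, hz, hfix (1, 0), hfix (0, 1), ?_⟩
  have hanti : Antitone fun n => ‖x (n + 1) - z‖ := by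
    refine antitone_nat_of_succ_le fun n => ?_
    have hn : 1 ≤ n + 1 := Nat.le_add_left 1 n
    have h1 := hA (hxC _ hn) hz hn
    rw [show squareAvg (S z) (n + 1) = z by
      rw [funext hfix]; exact squareAvg_const z hn] at h1
    have h2 : x (n + 1 + 1) - z = α (n + 1) • (squareAvg (S (x (n + 1))) (n + 1) - z)
        + (1 - α (n + 1)) • (x (n + 1) - z) := by
      rw [hrec' _ hn]; module
    obtain ⟨h0, h0'⟩ := hα (n + 1)
    rw [h2]
    refine (norm_add_le _ _).trans ?_
    rw [norm_smul, norm_smul, Real.norm_of_nonneg h0, Real.norm_of_nonneg (by linarith)]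
    linarith [mul_le_mul_of_nonneg_left h1 h0]
  have hconv : Tendsto (fun n => ‖x n - z‖) atTop (nhds (⨅ n, ‖x (n + 1) - z‖)) :=
    (tendsto_add_atTop_iff_nat 1).1
      (tendsto_atTop_ciInf hanti ⟨0, Set.forall_mem_range.2 fun n => norm_nonneg _⟩)
  rw [tendsto_nhds_unique (hconv.mono_left hF)
    (tendsto_iff_norm_sub_tendsto_zero.1 hxz)] at hconv
  exact tendsto_iff_norm_sub_tendsto_zero.2 hconv
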